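/- Fix L ≥ 1, a potential V : 𝔾 → ℝ, and let X^L be any operator in 𝒯_L = {H^{𝔾_L,S}, H^{𝔾_L,N}, H^{𝔾_L,D}, H^{G̃_L,S}, H^{G̃_L,N}, H^{G̃_L,D}}. Write 𝔾_L = 𝔾_{L−1,1} ∪ 𝔾_{L−1,2} ∪ 𝔾_{L−1,3} as the union of its three constituent 2^{L−1}-triangles, and let X^{L−1,i}, i=1,2,3, be the operators with the same boundary condition as X^L on the 2^{L−1}-triangles (respectively, on their truncated triangles if X^L is on G̃_L). Then for every E ∈ ℝ, |𝒩(E;X^L) − Σ_{i=1}^{3} 𝒩(E;X^{L−1,i})| ≤ 30. -/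

import Mathlib

open scoped Classical

noncomputable section

namespace SGL

/-- The vector `a₂ = (1,0)`. -/
def a2 : ℝ × ℝ := (1, 0)

/-- The vector `a₃ = (1/2, √3/2)`. -/
def a3 : ℝ × ℝ := (1/2, Real.sqrt 3 / 2)

/-- The vertex set of the unit triangle with lower-left corner `t`. -/
def tri (t : ℝ × ℝ) : Finset (ℝ × ℝ) := {t, t + a2, t + a3}

/-- The lower-left corners of the unit triangles making up `Tₙ`:
`T_{n+1} = T_n ∪ (T_n + 2ⁿ a₂) ∪ (T_n + 2ⁿ a₃)`. -/
def baseSet : ℕ → Finset (ℝ × ℝ)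
  | 0 => {(0, 0)}
  | (n+1) => baseSet n ∪ (baseSet n).image (· + (2 ^ n : ℝ) • a2)
      ∪ (baseSet n).image (· + (2 ^ n : ℝ) • a3)

/-- `𝔾ₙ`: the set of all vertices of the unit triangles composing `Tₙ`. -/
def VtxF (n : ℕ) : Finset (ℝ × ℝ) := (baseSet n).biUnion tri

/-- Reflection across the `y`-axis. -/
def reflY (p : ℝ × ℝ) : ℝ × ℝ := (-p.1, p.2)

/-- `(x,y) ∈ ℰₙ`: `x ≠ y` lie in a common unit triangle of `Tₙ`. -/
def EdgeIn (n : ℕ) (x y : ℝ × ℝ) : Prop :=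
  ∃ t ∈ baseSet n, x ∈ tri t ∧ y ∈ tri t ∧ x ≠ y

/-- Adjacency in the full Sierpinski lattice: an edge of some `ℰₙ` or of its mirror `ℰₙ′`. -/
def Adj (x y : ℝ × ℝ) : Prop :=
  (∃ n, EdgeIn n x y) ∨ (∃ n, EdgeIn n (reflY x) (reflY y))

/-- The vertex set `𝔾 = ⋃ₙ (𝔾ₙ ∪ 𝔾ₙ′)` of the full Sierpinski lattice. -/
def SG : Set (ℝ × ℝ) :=
  (⋃ n, (VtxF n : Set (ℝ × ℝ))) ∪ reflY '' (⋃ n, (VtxF n : Set (ℝ × ℝ)))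

/-- The type of vertices of the Sierpinski lattice. -/
abbrev Gpt := {p : ℝ × ℝ // p ∈ SG}

/-- `ℓ²(𝔾)` with real coefficients. -/
abbrev l2G := lp (fun _ : Gpt => ℝ) 2

/-- The essential support of a measure on `ℝ`. -/
def essSupp (P₀ : MeasureTheory.Measure ℝ) : Set ℝ :=
  {t : ℝ | ∀ ε > 0, 0 < P₀ (Set.Ioo (t - ε) (t + ε))}

end SGL

end

namespace SGL

/-- Degree of `x` in the full Sierpinski lattice `𝔾`. -/
noncomputable def degG (x : ℝ × ℝ) : ℕ := Set.ncard {y : ℝ × ℝ | Adj x y}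

/-- Degree of `x` within the subgraph induced by the finite vertex set `A`. -/
noncomputable def degIn (A : Finset (ℝ × ℝ)) (x : ℝ × ℝ) : ℕ :=
  (A.filter fun y => Adj x y).card

/-- Diagonal term for the three boundary conditions: `0 = S` (simple, i.e. `deg(x)`),
`1 = N` (Neumann, i.e. `deg_A(x)`), `2 = D` (modified Dirichlet, i.e. `2deg(x) − deg_A(x)`). -/
noncomputable def bcDiag : Fin 3 → Finset (ℝ × ℝ) → (ℝ × ℝ) → ℝ
  | 0, _, x => (degG x : ℝ)
  | 1, A, x => (degIn A x : ℝ)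
  | 2, A, x => 2 * (degG x : ℝ) - (degIn A x : ℝ)

/-- The matrix of `H^{A,•} = −Δ^{A,•} + V|_A` acting on `ℓ²(A)`, for boundary condition `b`. -/
noncomputable def HMat (b : Fin 3) (A : Finset (ℝ × ℝ)) (V : ℝ × ℝ → ℝ) :
    Matrix A A ℝ := fun x y =>
  (if (x : ℝ × ℝ) = (y : ℝ × ℝ) then bcDiag b A (x : ℝ × ℝ) + V (x : ℝ × ℝ) else 0)
    - (if Adj (x : ℝ × ℝ) (y : ℝ × ℝ) then 1 else 0)

/-- The eigenvalue counting function `𝒩(E;M)`: the number of eigenvalues of `M` that are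
`≤ E`, counted with multiplicity (the dimension of the span of the eigenspaces with
eigenvalue `≤ E`; for symmetric `M` this is the usual count). -/
noncomputable def evCount {ι : Type} [Fintype ι] (M : Matrix ι ι ℝ) (E : ℝ) : ℕ :=
  Module.finrank ℝ
    ↥(⨆ μ : {μ : ℝ // μ ≤ E}, Module.End.eigenspace (Matrix.mulVecLin M) (μ : ℝ))

/-- The three corner (extreme) vertices of `𝔾_ℓ`. -/
noncomputable def cornerF (ℓ : ℕ) : Finset (ℝ × ℝ) :=
  {(0, 0), (2 ^ ℓ : ℝ) • a2, (2 ^ ℓ : ℝ) • a3}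

/-- The truncated triangle `G̃_ℓ = 𝔾_ℓ` minus its three extreme vertices. -/
noncomputable def TruncF (ℓ : ℕ) : Finset (ℝ × ℝ) := VtxF ℓ \ cornerF ℓ

end SGL

namespace SGL

/-- The `2^ℓ`-triangle based at `c` (the translate of `𝔾_ℓ` by `c`). -/
noncomputable def triAt (ℓ : ℕ) (c : ℝ × ℝ) : Finset (ℝ × ℝ) := (VtxF ℓ).image (· + c)

/-- The truncated `2^ℓ`-triangle based at `c`. -/
noncomputable def truncAt (ℓ : ℕ) (c : ℝ × ℝ) : Finset (ℝ × ℝ) := (TruncF ℓ).image (· + c)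

/-- The region for the operator: the full triangle (`tr = false`) or its truncation
(`tr = true`). -/
noncomputable def region (tr : Bool) (ℓ : ℕ) (c : ℝ × ℝ) : Finset (ℝ × ℝ) :=
  if tr then truncAt ℓ c else triAt ℓ c

end SGL

open SGL

namespace SGL

section Glue

variable {ι o : Type} {κ : o → Type}

/-- Glue functions on the `κ i` to a function on `ι`, extended by zero off the range of `f`. -/
noncomputable def glue (f : (Σ i, κ i) → ι) : (∀ i, κ i → ℝ) →ₗ[ℝ] (ι → ℝ) :=
  Function.ExtendByZero.linearMap ℝ f ∘ₗ
    (LinearEquiv.piCurry ℝ (fun (i : o) (_ : κ i) => ℝ)).symm.toLinearMap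

theorem glue_apply {f : (Σ i, κ i) → ι} (hf : Function.Injective f) (u : ∀ i, κ i → ℝ)
    (i : o) (a : κ i) : glue f u (f ⟨i, a⟩) = u i a := by
  simp [glue, hf.extend_apply, Sigma.uncurry]

theorem glue_eq_zero (f : (Σ i, κ i) → ι) (u : ∀ i, κ i → ℝ) {x : ι}
    (hx : x ∉ Set.range f) : glue f u x = 0 :=
  Function.extend_apply' _ _ _ hx

theorem glue_injective {f : (Σ i, κ i) → ι} (hf : Function.Injective f) :
    Function.Injective (glue f) := fun u v h => by
  funext i a
  rw [← glue_apply hf u, ← glue_apply hf v, h]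

end Glue

section LinearAlgebra

open Matrix Module

variable {ι : Type} [Fintype ι]

/-- The span of the eigenspaces of `M` whose eigenvalues satisfy `P`. -/
def spectralSpan (M : Matrix ι ι ℝ) (P : ℝ → Prop) : Submodule ℝ (ι → ℝ) :=
  ⨆ μ : {μ : ℝ // P μ}, End.eigenspace (mulVecLin M) (μ : ℝ)

/-- The quadratic form of `M - E`. -/
def shiftedForm (M : Matrix ι ι ℝ) (E : ℝ) (x : ι → ℝ) : ℝ :=
  x ⬝ᵥ M *ᵥ x - E * (x ⬝ᵥ x)

/-- The coefficient of `x` along the `i`-th vector of an orthonormal eigenbasis of `M`. -/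
noncomputable def eigenCoeff {M : Matrix ι ι ℝ} (hM : M.IsHermitian) (x : ι → ℝ) (i : ι) : ℝ :=
  WithLp.ofLp (hM.eigenvectorBasis i) ⬝ᵥ x

theorem eigenCoeff_mulVec {M : Matrix ι ι ℝ} (hM : M.IsHermitian) (x : ι → ℝ) (i : ι) :
    eigenCoeff hM (M *ᵥ x) i = hM.eigenvalues i * eigenCoeff hM x i := by
  have hT : Mᵀ = M := by
    rwa [IsHermitian, conjTranspose_eq_transpose_of_trivial] at hM
  rw [eigenCoeff, dotProduct_mulVec, ← mulVec_transpose, hT, hM.mulVec_eigenvectorBasis,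
    smul_dotProduct, smul_eq_mul, eigenCoeff]

theorem sum_eigenCoeff_mul {M : Matrix ι ι ℝ} (hM : M.IsHermitian) (x y : ι → ℝ) :
    ∑ i, eigenCoeff hM x i * eigenCoeff hM y i = x ⬝ᵥ y := by
  have h := hM.eigenvectorBasis.sum_inner_mul_inner (WithLp.toLp 2 x) (WithLp.toLp 2 y)
  simp only [EuclideanSpace.inner_eq_star_dotProduct, star_trivial] at h
  rw [dotProduct_comm x y, ← h]
  exact Finset.sum_congr rfl fun i _ => by
    rw [eigenCoeff, eigenCoeff, dotProduct_comm _ y]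

theorem shiftedForm_eq_sum {M : Matrix ι ι ℝ} (hM : M.IsHermitian) (E : ℝ) (x : ι → ℝ) :
    shiftedForm M E x = ∑ i, (hM.eigenvalues i - E) * eigenCoeff hM x i ^ 2 := by
  rw [shiftedForm, ← sum_eigenCoeff_mul hM, ← sum_eigenCoeff_mul hM, Finset.mul_sum,
    ← Finset.sum_sub_distrib]
  exact Finset.sum_congr rfl fun i _ => by rw [eigenCoeff_mulVec]; ring

theorem eigenCoeff_eq_zero {M : Matrix ι ι ℝ} (hM : M.IsHermitian) {P : ℝ → Prop}
    {x : ι → ℝ} (hx : x ∈ spectralSpan M P) {i : ι} (hi : ¬ P (hM.eigenvalues i)) :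
    eigenCoeff hM x i = 0 := by
  refine Submodule.iSup_induction _ (motive := fun x => eigenCoeff hM x i = 0) hx ?_ ?_ ?_
  · rintro ⟨μ, hμ⟩ y hy
    have h := eigenCoeff_mulVec hM y i
    rw [← mulVecLin_apply, End.mem_eigenspace_iff.1 hy, eigenCoeff, dotProduct_smul,
      smul_eq_mul, ← eigenCoeff] at h
    have hne : μ - hM.eigenvalues i ≠ 0 := fun h0 => hi (by rwa [← sub_eq_zero.1 h0])
    refine (mul_eq_zero.1 ?_).resolve_left hne
    linear_combination h
  · simp [eigenCoeff]
  · intro y z hy hz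
    rw [eigenCoeff] at hy hz ⊢
    rw [dotProduct_add, hy, hz, add_zero]

theorem shiftedForm_nonpos_of_mem {M : Matrix ι ι ℝ} (hM : M.IsHermitian) {E : ℝ}
    {x : ι → ℝ} (hx : x ∈ spectralSpan M (· ≤ E)) : shiftedForm M E x ≤ 0 := by
  rw [shiftedForm_eq_sum hM]
  refine Finset.sum_nonpos fun i _ => ?_
  by_cases hi : hM.eigenvalues i ≤ E
  · exact mul_nonpos_of_nonpos_of_nonneg (sub_nonpos.2 hi) (sq_nonneg _)
  · simp [eigenCoeff_eq_zero hM hx hi]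

theorem shiftedForm_pos_of_mem {M : Matrix ι ι ℝ} (hM : M.IsHermitian) {E : ℝ}
    {x : ι → ℝ} (hx : x ∈ spectralSpan M (E < ·)) (hx0 : x ≠ 0) : 0 < shiftedForm M E x := by
  rw [shiftedForm_eq_sum hM]
  have hnn : ∀ i, 0 ≤ (hM.eigenvalues i - E) * eigenCoeff hM x i ^ 2 := fun i => by
    by_cases hi : E < hM.eigenvalues i
    · exact mul_nonneg (sub_pos.2 hi).le (sq_nonneg _)
    · simp [eigenCoeff_eq_zero hM hx hi]
  obtain ⟨i, hi⟩ : ∃ i, eigenCoeff hM x i ≠ 0 := by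
    by_contra! h
    refine hx0 (dotProduct_self_eq_zero.1 ?_)
    rw [← sum_eigenCoeff_mul hM]
    simp [h]
  refine Finset.sum_pos' (fun i _ => hnn i) ⟨i, Finset.mem_univ _, ?_⟩
  by_cases hE : E < hM.eigenvalues i
  · exact mul_pos (sub_pos.2 hE) (by positivity)
  · exact absurd (eigenCoeff_eq_zero hM hx hE) hi

theorem spectralSpan_sup_eq_top {M : Matrix ι ι ℝ} (hM : M.IsHermitian) (E : ℝ) :
    spectralSpan M (· ≤ E) ⊔ spectralSpan M (E < ·) = ⊤ := by
  rw [eq_top_iff]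
  intro x _
  have hx : x = ∑ i, eigenCoeff hM x i • WithLp.ofLp (hM.eigenvectorBasis i) := by
    have h := hM.eigenvectorBasis.sum_repr' (WithLp.toLp 2 x)
    have h' := congrArg WithLp.ofLp h
    rw [WithLp.ofLp_sum] at h'
    refine h'.symm.trans (Finset.sum_congr rfl fun i _ => ?_)
    rw [WithLp.ofLp_smul, eigenCoeff, dotProduct_comm]
    simp [EuclideanSpace.inner_eq_star_dotProduct]
  rw [hx]
  refine Submodule.sum_mem _ fun i _ => Submodule.smul_mem _ _ ?_
  have hmem : WithLp.ofLp (hM.eigenvectorBasis i) ∈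
      End.eigenspace (mulVecLin M) (hM.eigenvalues i) :=
    End.mem_eigenspace_iff.2 (hM.mulVec_eigenvectorBasis i)
  by_cases hi : hM.eigenvalues i ≤ E
  · exact Submodule.mem_sup_left (Submodule.mem_iSup_of_mem
      (⟨_, hi⟩ : {μ : ℝ // μ ≤ E}) hmem)
  · exact Submodule.mem_sup_right (Submodule.mem_iSup_of_mem
      (⟨_, not_le.1 hi⟩ : {μ : ℝ // E < μ}) hmem)

theorem finrank_add_le_of_disjoint {U W : Type*} [AddCommGroup U] [Module ℝ U]
    [AddCommGroup W] [Module ℝ W] [FiniteDimensional ℝ U] {g : W →ₗ[ℝ] U}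
    (hg : Function.Injective g) {S : Submodule ℝ U} (h : ∀ w, g w ∈ S → w = 0) :
    finrank ℝ W + finrank ℝ S ≤ finrank ℝ U := by
  rw [← LinearMap.finrank_range_of_inj hg]
  refine Submodule.finrank_add_finrank_le_of_disjoint (Submodule.disjoint_def.2 ?_)
  rintro _ ⟨w, rfl⟩ hw
  rw [h w hw, map_zero]

theorem evCount_add_finrank {M : Matrix ι ι ℝ} (hM : M.IsHermitian) (E : ℝ) :
    evCount M E + finrank ℝ (spectralSpan M (E < ·)) = Fintype.card ι := by
  refine le_antisymm ?_ ?_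
  · rw [← finrank_fintype_fun_eq_card ℝ]
    refine finrank_add_le_of_disjoint (g := (spectralSpan M (· ≤ E)).subtype)
      Subtype.val_injective fun w hw => ?_
    by_contra h0
    have h1 := shiftedForm_pos_of_mem hM hw fun h => h0 (Subtype.ext h)
    exact absurd (shiftedForm_nonpos_of_mem hM w.2) (not_le.2 h1)
  · rw [← finrank_fintype_fun_eq_card ℝ, ← finrank_top ℝ (ι → ℝ),
      ← spectralSpan_sup_eq_top hM E]
    exact Submodule.finrank_add_le_finrank_add_finrank _ _

theorem finrank_le_evCount {M : Matrix ι ι ℝ} (hM : M.IsHermitian) {E : ℝ} {W : Type*}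
    [AddCommGroup W] [Module ℝ W] {g : W →ₗ[ℝ] (ι → ℝ)} (hg : Function.Injective g)
    (h : ∀ w, shiftedForm M E (g w) ≤ 0) : finrank ℝ W ≤ evCount M E := by
  have h1 := evCount_add_finrank hM E
  have h2 : finrank ℝ W + finrank ℝ (spectralSpan M (E < ·)) ≤ finrank ℝ (ι → ℝ) := by
    refine finrank_add_le_of_disjoint hg fun w hw => ?_
    by_contra h0
    exact absurd (h w) (not_le.2 (shiftedForm_pos_of_mem hM hw
      fun hw0 => h0 (hg (hw0.trans (map_zero g).symm))))
  rw [finrank_fintype_fun_eq_card] at h2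
  omega

theorem finrank_add_evCount_le {M : Matrix ι ι ℝ} (hM : M.IsHermitian) {E : ℝ} {W : Type*}
    [AddCommGroup W] [Module ℝ W] {g : W →ₗ[ℝ] (ι → ℝ)} (hg : Function.Injective g)
    (h : ∀ w, w ≠ 0 → 0 < shiftedForm M E (g w)) :
    finrank ℝ W + evCount M E ≤ Fintype.card ι := by
  rw [← finrank_fintype_fun_eq_card ℝ]
  refine finrank_add_le_of_disjoint hg fun w hw => ?_
  by_contra h0
  exact absurd (shiftedForm_nonpos_of_mem hM hw) (not_le.2 (h w h0))

variable {o : Type} [Fintype o] {κ : o → Type} [∀ i, Fintype (κ i)]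

theorem sum_glue_mul {f : (Σ i, κ i) → ι} (hf : Function.Injective f) (u : ∀ i, κ i → ℝ)
    (g : ι → ℝ) : ∑ x, glue f u x * g x = ∑ i, ∑ a, u i a * g (f ⟨i, a⟩) := by
  rw [← Fintype.sum_sigma' fun i a => u i a * g (f ⟨i, a⟩)]
  refine (Fintype.sum_of_injective f hf _ _ (fun x hx => ?_) fun p => ?_).symm
  · rw [glue_eq_zero f u hx, zero_mul]
  · rw [← glue_apply hf u]

theorem shiftedForm_glue {f : (Σ i, κ i) → ι} (hf : Function.Injective f)
    {M : Matrix ι ι ℝ} {N : ∀ i, Matrix (κ i) (κ i) ℝ}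
    (hN : ∀ i a b, M (f ⟨i, a⟩) (f ⟨i, b⟩) = N i a b)
    (hM : ∀ i j a b, i ≠ j → M (f ⟨i, a⟩) (f ⟨j, b⟩) = 0) (E : ℝ) (u : ∀ i, κ i → ℝ) :
    shiftedForm M E (glue f u) = ∑ i, shiftedForm (N i) E (u i) := by
  have h1 : glue f u ⬝ᵥ glue f u = ∑ i, u i ⬝ᵥ u i := by
    rw [dotProduct, sum_glue_mul hf]
    simp only [glue_apply hf, dotProduct]
  have h2 : glue f u ⬝ᵥ M *ᵥ glue f u = ∑ i, u i ⬝ᵥ N i *ᵥ u i := by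
    rw [dotProduct, sum_glue_mul hf]
    refine Finset.sum_congr rfl fun i _ => Finset.sum_congr rfl fun a _ => ?_
    congr 1
    simp only [mulVec, dotProduct]
    simp_rw [mul_comm (M _ _)]
    rw [sum_glue_mul hf, Finset.sum_eq_single i]
    · simp_rw [hN, mul_comm]
    · intro j _ hj
      simp [hM i j a _ hj.symm]
    · simp
  simp only [shiftedForm, h1, h2, Finset.sum_sub_distrib, Finset.mul_sum]

/-- Interlacing: if `M` is block diagonal on a family of disjoint subsets with blocks `N i`,
then the sum of the counting functions of the blocks is within the number of remaining indices
of the counting function of `M`. -/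
theorem evCount_interlacing {f : (Σ i, κ i) → ι} (hf : Function.Injective f)
    {M : Matrix ι ι ℝ} (hMH : M.IsHermitian) {N : ∀ i, Matrix (κ i) (κ i) ℝ}
    (hN : ∀ i a b, M (f ⟨i, a⟩) (f ⟨i, b⟩) = N i a b)
    (hM : ∀ i j a b, i ≠ j → M (f ⟨i, a⟩) (f ⟨j, b⟩) = 0) (E : ℝ) :
    ∑ i, evCount (N i) E ≤ evCount M E ∧
      evCount M E + ∑ i, Fintype.card (κ i) ≤ ∑ i, evCount (N i) E + Fintype.card ι := by
  have hNH : ∀ i, (N i).IsHermitian := fun i => by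
    ext a b
    rw [conjTranspose_apply, ← hN, ← hN, ← conjTranspose_apply, hMH]
  let lift (P : ℝ → Prop) : (∀ i, spectralSpan (N i) P) →ₗ[ℝ] (ι → ℝ) :=
    glue f ∘ₗ LinearMap.piMap fun i => (spectralSpan (N i) P).subtype
  have hinj : ∀ P, Function.Injective (lift P) := fun P =>
    (glue_injective hf).comp (Function.Injective.piMap fun i => Subtype.val_injective)
  have hform : ∀ P w, shiftedForm M E (lift P w) = ∑ i, shiftedForm (N i) E (w i) :=
    fun P w => shiftedForm_glue hf hN hM E _
  have low := finrank_le_evCount hMH (E := E) (hinj (· ≤ E)) fun w => by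
    rw [hform]
    exact Finset.sum_nonpos fun i _ => shiftedForm_nonpos_of_mem (hNH i) (w i).2
  have high := finrank_add_evCount_le hMH (E := E) (hinj (E < ·)) fun w hw => by
    rw [hform]
    have hpos : ∀ i, w i ≠ 0 → 0 < shiftedForm (N i) E (w i) := fun i hi =>
      shiftedForm_pos_of_mem (hNH i) (w i).2 fun h => hi (Subtype.ext h)
    obtain ⟨i, hi⟩ := Function.ne_iff.1 hw
    refine Finset.sum_pos' (fun j _ => ?_) ⟨i, Finset.mem_univ _, hpos i hi⟩
    by_cases hj : w j = 0
    · simp [hj, shiftedForm]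
    · exact (hpos j hj).le
  rw [finrank_pi_fintype] at low high
  refine ⟨low, ?_⟩
  simp_rw [← fun i => evCount_add_finrank (hNH i) E]
  rw [Finset.sum_add_distrib]
  omega

end LinearAlgebra

end SGL

namespace SGL

theorem EdgeIn.symm {n : ℕ} {x y : ℝ × ℝ} (h : EdgeIn n x y) : EdgeIn n y x := by
  obtain ⟨t, ht, hx, hy, hne⟩ := h
  exact ⟨t, ht, hy, hx, hne.symm⟩

theorem Adj.symm {x y : ℝ × ℝ} (h : Adj x y) : Adj y x :=
  h.imp (fun ⟨n, hn⟩ => ⟨n, hn.symm⟩) (fun ⟨n, hn⟩ => ⟨n, hn.symm⟩)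

theorem adj_comm {x y : ℝ × ℝ} : Adj x y ↔ Adj y x := ⟨Adj.symm, Adj.symm⟩

theorem HMat_isHermitian (b : Fin 3) (A : Finset (ℝ × ℝ)) (V : ℝ × ℝ → ℝ) :
    (HMat b A V).IsHermitian := by
  ext x y
  rw [Matrix.conjTranspose_apply, star_trivial]
  simp only [HMat, adj_comm (x := (x : ℝ × ℝ))]
  by_cases h : (x : ℝ × ℝ) = y
  · simp [h]
  · simp [h, Ne.symm h]

theorem bcDiag_congr (b : Fin 3) {A A' : Finset (ℝ × ℝ)} {x : ℝ × ℝ}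
    (h : degIn A x = degIn A' x) : bcDiag b A x = bcDiag b A' x := by
  fin_cases b <;> simp [bcDiag, h]

/-- If the disjoint sets `B i ⊆ A ∩ A' i` are mutually non-adjacent and the vertices of `B i`
have the same degree in `A` and in `A' i`, then the counting function of `A` differs from the
sum of those of the `A' i` by at most the number of vertices outside the `B i`. -/
theorem abs_evCount_sub_sum_le {o : Type} [Fintype o] (b : Fin 3) (V : ℝ × ℝ → ℝ) (E : ℝ)
    {A : Finset (ℝ × ℝ)} {A' B : o → Finset (ℝ × ℝ)} (hBA : ∀ i, B i ⊆ A)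
    (hBA' : ∀ i, B i ⊆ A' i) (hdisj : ∀ i j x, x ∈ B i → x ∈ B j → i = j)
    (hadj : ∀ i j x y, x ∈ B i → y ∈ B j → Adj x y → i = j)
    (hdeg : ∀ i, ∀ x ∈ B i, degIn A x = degIn (A' i) x) {m : ℕ}
    (hA : A.card ≤ ∑ i, (B i).card + m) (hA' : ∑ i, (A' i).card ≤ ∑ i, (B i).card + m) :
    |(evCount (HMat b A V) E : ℤ) - ∑ i, (evCount (HMat b (A' i) V) E : ℤ)| ≤ m := by
  let N (i : o) : Matrix (B i) (B i) ℝ := fun x y =>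
    HMat b A V ⟨x, hBA i x.2⟩ ⟨y, hBA i y.2⟩
  have hbig := evCount_interlacing (f := fun p : Σ i, B i => (⟨p.2, hBA p.1 p.2.2⟩ : A))
    (fun p q hpq => by
      obtain ⟨i, x, hx⟩ := p
      obtain ⟨j, y, hy⟩ := q
      obtain rfl : x = y := congrArg Subtype.val hpq
      obtain rfl := hdisj i j x hx hy
      rfl)
    (HMat_isHermitian b A V) (N := N) (fun _ _ _ => rfl)
    (fun i j x y hij => by
      have h1 : (x : ℝ × ℝ) ≠ y := fun h => hij (hdisj i j x x.2 (h ▸ y.2))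
      have h2 : ¬ Adj (x : ℝ × ℝ) y := fun h => hij (hadj i j x y x.2 y.2 h)
      simp [HMat, h1, h2]) E
  have hsmall (i : o) := evCount_interlacing (o := Unit) (κ := fun _ => B i)
    (f := fun p => (⟨p.2, hBA' i p.2.2⟩ : A' i))
    (fun p q hpq => by
      obtain ⟨⟨⟩, x, hx⟩ := p
      obtain ⟨⟨⟩, y, hy⟩ := q
      obtain rfl : x = y := congrArg Subtype.val hpq
      rfl)
    (HMat_isHermitian b (A' i) V) (N := fun _ => N i)
    (fun _ x y => by simp only [N, HMat, bcDiag_congr b (hdeg i x x.2)])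
    (fun i j _ _ hij => absurd (Subsingleton.elim i j) hij) E
  simp only [Fintype.card_coe, Finset.univ_unique, Finset.sum_const, Finset.card_singleton,
    one_smul] at hbig hsmall
  have hlow := Finset.sum_le_sum fun i (_ : i ∈ Finset.univ) => (hsmall i).1
  have hhigh := Finset.sum_le_sum fun i (_ : i ∈ Finset.univ) => (hsmall i).2
  rw [Finset.sum_add_distrib, Finset.sum_add_distrib] at hhigh
  rw [← Nat.cast_sum, abs_le]
  constructor <;> omega

/-- The point of the triangular lattice with integer coordinates `q` in the basis `a2, a3`. -/
noncomputable def pt : ℤ × ℤ →+ ℝ × ℝ where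
  toFun q := ((q.1 : ℝ) + (q.2 : ℝ) / 2, (q.2 : ℝ) * (Real.sqrt 3 / 2))
  map_zero' := by simp
  map_add' p q := by ext <;> simp <;> ring

theorem pt_apply (q : ℤ × ℤ) : pt q = ((q.1 : ℝ) + (q.2 : ℝ) / 2, (q.2 : ℝ) * (Real.sqrt 3 / 2)) := rfl

theorem pt_injective : Function.Injective pt := by
  rw [injective_iff_map_eq_zero]
  rintro ⟨i, j⟩ h
  have h3 : Real.sqrt 3 ≠ 0 := by positivity
  simp only [pt_apply, Prod.mk_eq_zero, mul_eq_zero, div_eq_zero_iff, h3] at h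
  obtain ⟨h1, h2⟩ := h
  obtain rfl : j = 0 := by simpa using h2
  simpa using h1

theorem pt_zero : pt (0, 0) = (0, 0) := map_zero pt

theorem pow_smul_a2 (n : ℕ) : (2 ^ n : ℝ) • a2 = pt (2 ^ n, 0) := by
  simp [pt_apply, a2]

theorem pow_smul_a3 (n : ℕ) : (2 ^ n : ℝ) • a3 = pt (0, 2 ^ n) := by
  simp [pt_apply, a3, div_eq_mul_inv]

/-- Coordinates of the lower-left corners of the three constituent triangles of `𝔾_{n+1}`,
which are also the extreme vertices of `𝔾ₙ`. -/
def shift (n : ℕ) : Fin 3 → ℤ × ℤ := ![(0, 0), (2 ^ n, 0), (0, 2 ^ n)]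

theorem mem_cornerF {n : ℕ} {p : ℝ × ℝ} : p ∈ cornerF n ↔ ∃ k, p = pt (shift n k) := by
  simp only [cornerF, pow_smul_a2, pow_smul_a3, Finset.mem_insert, Finset.mem_singleton,
    Fin.exists_fin_succ, shift, ← pt_zero]
  simp

theorem mem_triAt {n : ℕ} {c p : ℝ × ℝ} : p ∈ triAt n c ↔ p - c ∈ VtxF n := by
  simp [triAt, ← sub_eq_add_neg]

theorem mem_region {tr : Bool} {n : ℕ} {c p : ℝ × ℝ} :
    p ∈ region tr n c ↔ p - c ∈ VtxF n ∧ (tr = true → p - c ∉ cornerF n) := by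
  cases tr
  · simp [region, mem_triAt]
  · simp [region, truncAt, TruncF, ← sub_eq_add_neg]

theorem mem_tri {t x : ℝ × ℝ} :
    x ∈ tri t ↔ ∃ u : ℤ × ℤ, 0 ≤ u.1 ∧ 0 ≤ u.2 ∧ u.1 + u.2 ≤ 1 ∧ x = t + pt u := by
  have h2 : a2 = pt (1, 0) := by simpa using pow_smul_a2 0
  have h3 : a3 = pt (0, 1) := by simpa using pow_smul_a3 0
  simp only [tri, Finset.mem_insert, Finset.mem_singleton, h2, h3]
  constructor
  · rintro (rfl | rfl | rfl)
    exacts [⟨(0, 0), by simp [← Prod.zero_eq_mk]⟩, ⟨(1, 0), by simp⟩, ⟨(0, 1), by simp⟩]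
  · rintro ⟨⟨i, j⟩, hi, hj, hij, rfl⟩
    have : i = 0 ∧ j = 0 ∨ i = 1 ∧ j = 0 ∨ i = 0 ∧ j = 1 := by dsimp only at *; omega
    rcases this with ⟨rfl, rfl⟩ | ⟨rfl, rfl⟩ | ⟨rfl, rfl⟩ <;> simp [← Prod.zero_eq_mk]

theorem mem_VtxF_succ {n : ℕ} {p : ℝ × ℝ} :
    p ∈ VtxF (n + 1) ↔ ∃ k, p - pt (shift n k) ∈ VtxF n := by
  have key : ∀ c t, p ∈ tri (t + c) ↔ p - c ∈ tri t := fun c t => by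
    simp only [mem_tri, sub_eq_iff_eq_add, add_right_comm]
  simp only [VtxF, baseSet, Finset.mem_biUnion, Finset.mem_union, Finset.mem_image,
    pow_smul_a2, pow_smul_a3, Fin.exists_fin_succ, shift, or_and_right, exists_or, ← key]
  simp [or_assoc, pt_zero]

theorem exists_pt_of_mem_VtxF {n : ℕ} {p : ℝ × ℝ} (hp : p ∈ VtxF n) :
    ∃ q : ℤ × ℤ, 0 ≤ q.1 ∧ 0 ≤ q.2 ∧ q.1 + q.2 ≤ 2 ^ n ∧ p = pt q := by
  induction n generalizing p with
  | zero =>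
    simp only [VtxF, baseSet, Finset.singleton_biUnion, mem_tri] at hp
    simpa [← Prod.zero_eq_mk] using hp
  | succ n ih =>
    obtain ⟨k, hk⟩ := mem_VtxF_succ.1 hp
    obtain ⟨q, h1, h2, h3, h4⟩ := ih hk
    have hs : (0 : ℤ) < 2 ^ n := by positivity
    refine ⟨q + shift n k, ?_, ?_, ?_, by rw [map_add, ← h4, sub_add_cancel]⟩ <;>
    fin_cases k <;> simp [shift, pow_succ] <;> omega

theorem EdgeIn.exists_sub_eq {n : ℕ} {x y : ℝ × ℝ} (h : EdgeIn n x y) :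
    ∃ d : ℤ × ℤ, |d.1| ≤ 1 ∧ |d.2| ≤ 1 ∧ |d.1 + d.2| ≤ 1 ∧ x - y = pt d := by
  obtain ⟨t, -, hx, hy, -⟩ := h
  obtain ⟨u, hu1, hu2, hu3, rfl⟩ := mem_tri.1 hx
  obtain ⟨v, hv1, hv2, hv3, rfl⟩ := mem_tri.1 hy
  refine ⟨u - v, ?_, ?_, ?_, by rw [map_sub]; abel⟩ <;>
  · simp only [Prod.fst_sub, Prod.snd_sub, abs_le]
    omega

theorem Adj.exists_sub_eq {x y : ℝ × ℝ} (h : Adj x y) :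
    ∃ d : ℤ × ℤ, |d.1| ≤ 1 ∧ |d.2| ≤ 1 ∧ |d.1 + d.2| ≤ 1 ∧ x - y = pt d := by
  obtain ⟨n, hn⟩ | ⟨n, hn⟩ := h
  · exact hn.exists_sub_eq
  · obtain ⟨d, h1, h2, h3, h4⟩ := hn.exists_sub_eq
    refine ⟨(-(d.1 + d.2), d.2), by rwa [abs_neg], h2, ?_, ?_⟩
    · rwa [neg_add, neg_add_cancel_right, abs_neg]
    · simp only [reflY, pt_apply, Prod.mk_sub_mk, Prod.mk.injEq] at h4
      rw [pt_apply, Prod.ext_iff]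
      push_cast
      refine ⟨?_, h4.2⟩
      simp only [Prod.fst_sub]
      linarith [h4.1]

/-- The extreme vertices of `𝔾ₙ` and their neighbours in `𝔾ₙ`. -/
noncomputable def collar (n : ℕ) : Finset (ℝ × ℝ) :=
  ([(0, 0), (1, 0), (0, 1), (2 ^ n, 0), (2 ^ n - 1, 0), (2 ^ n - 1, 1), (0, 2 ^ n),
    (0, 2 ^ n - 1), (1, 2 ^ n - 1)].map pt).toFinset

theorem card_collar_le (n : ℕ) : (collar n).card ≤ 9 :=
  List.toFinset_card_le _

/-- The vertices of `𝔾ₙ + c` away from the extreme vertices. -/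
noncomputable def coreAt (n : ℕ) (c : ℝ × ℝ) : Finset (ℝ × ℝ) :=
  (VtxF n \ collar n).image (· + c)

theorem mem_coreAt {n : ℕ} {c p : ℝ × ℝ} :
    p ∈ coreAt n c ↔ p - c ∈ VtxF n ∧ p - c ∉ collar n := by
  simp [coreAt, ← sub_eq_add_neg]

theorem mem_collar_of_lt {n : ℕ} {q : ℤ × ℤ} (h1 : 0 ≤ q.1) (h2 : 0 ≤ q.2)
    (h3 : q.1 + q.2 ≤ 2 ^ n)
    (h : q.1 + q.2 < 2 ∨ 2 ^ n - 2 < q.1 ∨ 2 ^ n - 2 < q.2) : pt q ∈ collar n := by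
  simp only [collar, List.mem_toFinset, List.mem_map_of_injective pt_injective,
    List.mem_cons, List.not_mem_nil, or_false, Prod.ext_iff]
  omega

theorem cornerF_subset_collar (n : ℕ) : cornerF n ⊆ collar n := by
  intro p hp
  obtain ⟨k, rfl⟩ := mem_cornerF.1 hp
  refine mem_collar_of_lt ?_ ?_ ?_ ?_ <;> fin_cases k <;> simp [shift]

theorem exists_pt_of_mem_coreAt {n : ℕ} {c : ℤ × ℤ} {p : ℝ × ℝ} (hp : p ∈ coreAt n (pt c)) :
    ∃ q : ℤ × ℤ, 0 ≤ q.1 ∧ 0 ≤ q.2 ∧ 2 ≤ q.1 + q.2 ∧ q.1 + q.2 ≤ 2 ^ n ∧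
      q.1 ≤ 2 ^ n - 2 ∧ q.2 ≤ 2 ^ n - 2 ∧ p = pt (q + c) := by
  obtain ⟨h, hc⟩ := mem_coreAt.1 hp
  obtain ⟨q, h1, h2, h3, h4⟩ := exists_pt_of_mem_VtxF h
  rw [h4] at hc
  have := mt (mem_collar_of_lt h1 h2 h3) hc
  push Not at this
  exact ⟨q, h1, h2, this.1, h3, this.2.1, this.2.2, by rw [map_add, ← h4, sub_add_cancel]⟩

theorem coreAt_subset_region (tr : Bool) (n : ℕ) (c : ℝ × ℝ) : coreAt n c ⊆ region tr n c := by
  intro p hp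
  obtain ⟨h, hc⟩ := mem_coreAt.1 hp
  exact mem_region.2 ⟨h, fun _ hc' => hc (cornerF_subset_collar n hc')⟩

theorem region_subset_region_succ (tr : Bool) (n : ℕ) (k : Fin 3) :
    region tr n (pt (shift n k)) ⊆ region tr (n + 1) 0 := by
  intro p hp
  obtain ⟨h, hc⟩ := mem_region.1 hp
  refine mem_region.2 ⟨by rw [sub_zero]; exact mem_VtxF_succ.2 ⟨k, h⟩, fun htr hp' => hc htr ?_⟩
  obtain ⟨q, h1, h2, h3, h4⟩ := exists_pt_of_mem_VtxF h
  obtain ⟨l, hl⟩ := mem_cornerF.1 hp'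
  have hq : q + shift n k = shift (n + 1) l :=
    pt_injective (by rw [map_add, ← h4, sub_add_cancel, ← hl, sub_zero])
  have hs : (0 : ℤ) < 2 ^ n := by positivity
  rw [h4, mem_cornerF]
  refine ⟨l, congrArg pt ?_⟩
  rw [Prod.ext_iff] at hq ⊢
  fin_cases k <;> fin_cases l <;> simp [shift, pow_succ] at hq ⊢ <;> omega

theorem eq_of_mem_coreAt {n : ℕ} {i j : Fin 3} {p : ℝ × ℝ}
    (hi : p ∈ coreAt n (pt (shift n i))) (hj : p ∈ coreAt n (pt (shift n j))) : i = j := by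
  obtain ⟨q, h⟩ := exists_pt_of_mem_coreAt hi
  obtain ⟨r, h'⟩ := exists_pt_of_mem_coreAt hj
  have hq : q + shift n i = r + shift n j :=
    pt_injective (h.2.2.2.2.2.2.symm.trans h'.2.2.2.2.2.2)
  rw [Prod.ext_iff] at hq
  fin_cases i <;> fin_cases j <;> simp [shift] at hq ⊢ <;> omega

theorem eq_of_adj_coreAt {n : ℕ} {i j : Fin 3} {x y : ℝ × ℝ}
    (hx : x ∈ coreAt n (pt (shift n i))) (hy : y - pt (shift n j) ∈ VtxF n) (h : Adj x y) :
    i = j ∧ y - pt (shift n j) ∉ cornerF n := by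
  obtain ⟨q, h1, h2, h3, h4, h5, h6, rfl⟩ := exists_pt_of_mem_coreAt hx
  obtain ⟨r, g1, g2, g3, hr⟩ := exists_pt_of_mem_VtxF hy
  obtain ⟨d, d1, d2, d3, hd⟩ := h.exists_sub_eq
  rw [abs_le] at d1 d2 d3
  rw [hr]
  obtain rfl : y = pt (r + shift n j) := by rw [map_add, ← hr, sub_add_cancel]
  rw [← map_sub] at hd
  have hq := pt_injective hd
  rw [Prod.ext_iff] at hq
  have hij : i = j := by
    fin_cases i <;> fin_cases j <;> simp [shift] at hq ⊢ <;> omega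
  subst hij
  refine ⟨rfl, fun hc => ?_⟩
  obtain ⟨k, hk⟩ := mem_cornerF.1 hc
  have hk' := pt_injective hk
  rw [Prod.ext_iff] at hk'
  simp only [add_sub_add_right_eq_sub, Prod.fst_sub, Prod.snd_sub] at hq
  fin_cases k <;> simp [shift] at hk' <;> omega

theorem degIn_region_eq {tr : Bool} {n : ℕ} {i : Fin 3} {x : ℝ × ℝ}
    (hx : x ∈ coreAt n (pt (shift n i))) :
    degIn (region tr (n + 1) 0) x = degIn (region tr n (pt (shift n i))) x := by
  rw [degIn, degIn]
  congr 1
  ext y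
  simp only [Finset.mem_filter, and_congr_left_iff]
  refine fun hxy => ⟨fun hy => ?_, fun hy => region_subset_region_succ tr n i hy⟩
  obtain ⟨j, hj⟩ := mem_VtxF_succ.1 (sub_zero y ▸ (mem_region.1 hy).1)
  obtain ⟨rfl, hc⟩ := eq_of_adj_coreAt hx hj hxy
  exact mem_region.2 ⟨hj, fun _ => hc⟩

theorem card_region_le (tr : Bool) (n : ℕ) (c : ℝ × ℝ) :
    (region tr n c).card ≤ (coreAt n c).card + 9 := by
  have hsub : region tr n c ⊆ coreAt n c ∪ (collar n).image (· + c) := fun p hp => by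
    have := (mem_region.1 hp).1
    by_cases hc : p - c ∈ collar n
    · exact Finset.mem_union_right _ (Finset.mem_image.2 ⟨_, hc, sub_add_cancel p c⟩)
    · exact Finset.mem_union_left _ (mem_coreAt.2 ⟨this, hc⟩)
  refine (Finset.card_le_card hsub).trans ((Finset.card_union_le _ _).trans ?_)
  exact Nat.add_le_add_left (Finset.card_image_le.trans (card_collar_le n)) _

theorem card_region_succ_le (tr : Bool) (n : ℕ) :
    (region tr (n + 1) 0).card ≤ ∑ k, (coreAt n (pt (shift n k))).card + 27 := by
  have hsub : region tr (n + 1) 0 ⊆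
      Finset.univ.biUnion fun k => region false n (pt (shift n k)) := fun p hp => by
    obtain ⟨k, hk⟩ := mem_VtxF_succ.1 (sub_zero p ▸ (mem_region.1 hp).1)
    exact Finset.mem_biUnion.2 ⟨k, Finset.mem_univ k, mem_region.2 ⟨hk, by simp⟩⟩
  refine (Finset.card_le_card hsub).trans (Finset.card_biUnion_le.trans ?_)
  refine (Finset.sum_le_sum fun k _ => card_region_le false n _).trans_eq ?_
  simp [Finset.sum_add_distrib]

end SGL

/-- For any operator `X^L ∈ 𝒯_L` (boundary condition `b`, on the full or
truncated triangle according to `tr`), and the corresponding operators `X^{L−1,i}` with the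
same boundary condition on the three constituent `2^{L−1}`-triangles
`𝔾_{L−1}`, `𝔾_{L−1} + 2^{L−1}a₂`, `𝔾_{L−1} + 2^{L−1}a₃` of `𝔾_L` (respectively, on their
truncations), the eigenvalue counting functions satisfy
`|𝒩(E;X^L) − Σᵢ 𝒩(E;X^{L−1,i})| ≤ 30`. -/
theorem counting_almost_subadditive (L : ℕ) (hL : 1 ≤ L) (V : ℝ × ℝ → ℝ) (E : ℝ)
    (b : Fin 3) (tr : Bool) :
    |(evCount (HMat b (region tr L (0, 0)) V) E : ℤ)
        - ((evCount (HMat b (region tr (L - 1) (0, 0)) V) E : ℤ)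
          + (evCount (HMat b (region tr (L - 1) ((2 ^ (L - 1) : ℝ) • a2)) V) E : ℤ)
          + (evCount (HMat b (region tr (L - 1) ((2 ^ (L - 1) : ℝ) • a3)) V) E : ℤ))|
      ≤ 30 := by
  obtain ⟨n, rfl⟩ := Nat.exists_eq_add_of_le' hL
  have h := abs_evCount_sub_sum_le b V E (A := region tr (n + 1) 0)
    (A' := fun k => region tr n (pt (shift n k))) (B := fun k => coreAt n (pt (shift n k)))
    (fun k => (coreAt_subset_region tr n _).trans (region_subset_region_succ tr n k))
    (fun k => coreAt_subset_region tr n _) (fun _ _ _ => eq_of_mem_coreAt)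
    (fun _ _ _ _ hx hy hxy => (eq_of_adj_coreAt hx (mem_coreAt.1 hy).1 hxy).1)
    (fun _ _ => degIn_region_eq) (card_region_succ_le tr n)
    ((Finset.sum_le_sum fun k _ => card_region_le tr n _).trans_eq
      (by simp [Finset.sum_add_distrib]))
  rw [Fin.sum_univ_three] at h
  have h0 : pt (shift n 0) = (0, 0) := map_zero pt
  have h1 : pt (shift n 1) = (2 ^ n : ℝ) • a2 := (pow_smul_a2 n).symm
  have h2 : pt (shift n 2) = (2 ^ n : ℝ) • a3 := (pow_smul_a3 n).symm
  rw [h0, h1, h2] at h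
  exact h.trans (by norm_num)
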